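/- An integrable function f on X belongs to H¹_r(X) if and only if there are type (a) atoms a_i, type (b) atoms b_j and scalars λ_i, μ_j with Σ|λ_i| + Σ|μ_j| < ∞ such that f = Σ λ_i a_i + Σ μ_j b_j with convergence in L¹(X,ν). Moreover there are constants c, C > 0 depending only on the doubling constant C_D such that c‖f‖_{H¹_r(X)} ≤ inf (Σ|λ_i| + Σ|μ_j|) ≤ C‖f‖_{H¹_r(X)}, the infimum being over all such decompositions. -/

import Mathlib

open MeasureTheory Metric Filter Set

noncomputable section

/-- The parabolic quasi-distance on `ℝ × E`. -/
def pdist {E : Type*} [MetricSpace E] (p q : ℝ × E) : ℝ :=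
  max (Real.sqrt |p.1 - q.1|) (dist p.2 q.2)

/-- The open parabolic ball in `N = ℝ × E`. -/
def pball {E : Type*} [MetricSpace E] (c : ℝ × E) (r : ℝ) : Set (ℝ × E) :=
  {p | pdist p c < r}

/-- The upper half space `X = (0,∞) × E` of `N = ℝ × E`. -/
def Xset (E : Type*) : Set (ℝ × E) := {p | 0 < p.1}

/-- The product measure `ν = Lebesgue ⊗ μ` on `N = ℝ × E`. -/
def pmeas {E : Type*} [MeasurableSpace E] (μ : Measure E) : Measure (ℝ × E) :=
  (volume : Measure ℝ).prod μ

/-- A `(1,2)`-atom on `N`: supported in a parabolic ball `Q`, mean value zero, and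
`‖a‖_{L²(ν)} ≤ ν(Q)^{-1/2}`. -/
def IsAtom12 {E : Type*} [MetricSpace E] [MeasurableSpace E]
    (μ : Measure E) (a : ℝ × E → ℝ) : Prop :=
  ∃ (c : ℝ × E) (r : ℝ), 0 < r ∧ Function.support a ⊆ pball c r ∧
    Integrable a (pmeas μ) ∧ (∫ p, a p ∂(pmeas μ)) = 0 ∧
    eLpNorm a 2 (pmeas μ) ≤ (pmeas μ (pball c r)) ^ (-(1:ℝ)/2)

/-- `f = Σ λ_i a_i` with convergence in `L¹(ρ)`. -/
def HasL1Decomp {E : Type*} [MeasurableSpace E] (ρ : Measure (ℝ × E))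
    (f : ℝ × E → ℝ) (lam : ℕ → ℝ) (a : ℕ → ℝ × E → ℝ) : Prop :=
  Summable (fun i => |lam i|) ∧
  Tendsto (fun k => eLpNorm (fun p => f p - ∑ i ∈ Finset.range k, lam i * a i p) 1 ρ)
    atTop (nhds 0)

/-- Membership in the atomic Hardy space `H¹(N)`. -/
def MemH1 {E : Type*} [MetricSpace E] [MeasurableSpace E]
    (μ : Measure E) (f : ℝ × E → ℝ) : Prop :=
  Integrable f (pmeas μ) ∧
  ∃ (lam : ℕ → ℝ) (a : ℕ → ℝ × E → ℝ), (∀ i, IsAtom12 μ (a i)) ∧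
    HasL1Decomp (pmeas μ) f lam a

/-- The `H¹(N)` norm: infimum of `Σ |λ_i|` over all atomic decompositions. -/
def H1norm {E : Type*} [MetricSpace E] [MeasurableSpace E]
    (μ : Measure E) (f : ℝ × E → ℝ) : ℝ :=
  sInf {c | ∃ (lam : ℕ → ℝ) (a : ℕ → ℝ × E → ℝ), (∀ i, IsAtom12 μ (a i)) ∧
    HasL1Decomp (pmeas μ) f lam a ∧ c = ∑' i, |lam i|}

/-- Membership in `H¹_r(X)`: `f ∈ L¹(X,ν)` is the restriction to `X` of some `F ∈ H¹(N)`. -/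
def MemH1r {E : Type*} [MetricSpace E] [MeasurableSpace E]
    (μ : Measure E) (f : ℝ × E → ℝ) : Prop :=
  IntegrableOn f (Xset E) (pmeas μ) ∧
  ∃ F : ℝ × E → ℝ, MemH1 μ F ∧ F =ᵐ[(pmeas μ).restrict (Xset E)] f

/-- The quotient norm on `H¹_r(X)`. -/
def H1rnorm {E : Type*} [MetricSpace E] [MeasurableSpace E]
    (μ : Measure E) (f : ℝ × E → ℝ) : ℝ :=
  sInf {c | ∃ F : ℝ × E → ℝ, MemH1 μ F ∧ F =ᵐ[(pmeas μ).restrict (Xset E)] f ∧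
    c = H1norm μ F}

/-- Membership in `H¹_z(X)`: the extension of `f` by zero belongs to `H¹(N)`. -/
def MemH1z {E : Type*} [MetricSpace E] [MeasurableSpace E]
    (μ : Measure E) (f : ℝ × E → ℝ) : Prop :=
  IntegrableOn f (Xset E) (pmeas μ) ∧ MemH1 μ ((Xset E).indicator f)

/-- The `H¹_z(X)` norm: the `H¹(N)` norm of the zero extension. -/
def H1znorm {E : Type*} [MetricSpace E] [MeasurableSpace E]
    (μ : Measure E) (f : ℝ × E → ℝ) : ℝ :=
  H1norm μ ((Xset E).indicator f)

/-- `μ` is doubling with constant `C_D`, with all balls of positive finite measure. -/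
def DoublingWith {E : Type*} [MetricSpace E] [MeasurableSpace E]
    (μ : Measure E) (C_D : ℝ) : Prop :=
  (∀ (x : E) (r : ℝ), 0 < r → 0 < μ (ball x r) ∧ μ (ball x r) < ⊤) ∧
  (∀ (x : E) (r : ℝ), 0 < r → μ (ball x (2 * r)) ≤ ENNReal.ofReal C_D * μ (ball x r))

/-- A type (a) atom: a `(1,2)`-atom whose supporting ball `Q` satisfies `4Q ⊆ X`. -/
def IsTypeAAtom {E : Type*} [MetricSpace E] [MeasurableSpace E]
    (μ : Measure E) (a : ℝ × E → ℝ) : Prop :=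
  ∃ (c : ℝ × E) (r : ℝ), 0 < r ∧ Function.support a ⊆ pball c r ∧
    pball c (4 * r) ⊆ Xset E ∧
    Integrable a (pmeas μ) ∧ (∫ p, a p ∂(pmeas μ)) = 0 ∧
    eLpNorm a 2 (pmeas μ) ≤ (pmeas μ (pball c r)) ^ (-(1:ℝ)/2)

/-- A type (b) atom: supported in a ball `Q` with `2Q ⊆ X`, `4Q ⊄ X`, with the `L²` size
condition but no cancellation. -/
def IsTypeBAtom {E : Type*} [MetricSpace E] [MeasurableSpace E]
    (μ : Measure E) (a : ℝ × E → ℝ) : Prop :=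
  ∃ (c : ℝ × E) (r : ℝ), 0 < r ∧ Function.support a ⊆ pball c r ∧
    pball c (2 * r) ⊆ Xset E ∧ ¬ (pball c (4 * r) ⊆ Xset E) ∧
    Integrable a (pmeas μ) ∧
    eLpNorm a 2 (pmeas μ) ≤ (pmeas μ (pball c r)) ^ (-(1:ℝ)/2)

/-- `f = Σ λ_i a_i + Σ μ_j b_j` in `L¹(X,ν)` with type (a) atoms `a_i` and type (b) atoms
`b_j`. -/
def HasRDecomp {E : Type*} [MetricSpace E] [MeasurableSpace E] (μ : Measure E)
    (f : ℝ × E → ℝ) (lamA : ℕ → ℝ) (aA : ℕ → ℝ × E → ℝ)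
    (lamB : ℕ → ℝ) (bB : ℕ → ℝ × E → ℝ) : Prop :=
  (∀ i, IsTypeAAtom μ (aA i)) ∧ (∀ j, IsTypeBAtom μ (bB j)) ∧
  Summable (fun i => |lamA i|) ∧ Summable (fun j => |lamB j|) ∧
  Tendsto (fun k => eLpNorm
      (fun p => f p - ∑ i ∈ Finset.range k, lamA i * aA i p
        - ∑ j ∈ Finset.range k, lamB j * bB j p) 1 ((pmeas μ).restrict (Xset E)))
    atTop (nhds 0)

/-- `g` is the sum of an absolutely convergent combination of elements of `A`, with coefficients
of total mass at most `s`. -/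
def AtomicBound {G : Type*} [NormedAddCommGroup G] [NormedSpace ℝ G] (A : Set G) (g : G)
    (s : ℝ) : Prop :=
  ∃ (lam : ℕ → ℝ) (a : ℕ → G), (∀ i, a i ∈ A) ∧ Summable (fun i => |lam i|) ∧
    ∑' i, |lam i| ≤ s ∧ HasSum (fun i => lam i • a i) g

section Atomic

variable {G G' : Type*} [NormedAddCommGroup G] [NormedSpace ℝ G] [NormedAddCommGroup G']
  [NormedSpace ℝ G'] {A : Set G} {A' : Set G'}

lemma norm_smul_le_abs {a : G} (ha : ‖a‖ ≤ 1) (c : ℝ) : ‖c • a‖ ≤ |c| := by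
  rw [norm_smul, Real.norm_eq_abs]
  exact mul_le_of_le_one_right (abs_nonneg c) ha

lemma summable_smul_of_summable_abs [CompleteSpace G] {ι : Type*} {lam : ι → ℝ} {a : ι → G}
    (ha : ∀ i, ‖a i‖ ≤ 1) (hl : Summable fun i => |lam i|) : Summable fun i => lam i • a i :=
  .of_norm_bounded hl fun i => norm_smul_le_abs (ha i) _

/-- Any countable index set may be used for an atomic sum, provided `0` is an atom. -/
lemma atomicBound_of_countable {ι : Type*} [Countable ι] {g : G} {s : ℝ} (h0 : (0 : G) ∈ A)
    {lam : ι → ℝ} {a : ι → G} (ha : ∀ i, a i ∈ A) (hl : Summable fun i => |lam i|)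
    (hs : ∑' i, |lam i| ≤ s) (hg : HasSum (fun i => lam i • a i) g) : AtomicBound A g s := by
  classical
  obtain ⟨e, he⟩ := exists_injective_nat ι
  have habs : (fun n => |Function.extend e lam 0 n|) = Function.extend e (fun i => |lam i|) 0 := by
    funext n
    by_cases hn : ∃ i, e i = n
    · obtain ⟨i, rfl⟩ := hn
      simp [he.extend_apply]
    · simp [Function.extend_apply' _ _ _ hn]
  have hsmul : (fun n => Function.extend e lam 0 n • Function.extend e a 0 n)
      = Function.extend e (fun i => lam i • a i) 0 := by
    funext n
    by_cases hn : ∃ i, e i = n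
    · obtain ⟨i, rfl⟩ := hn
      simp [he.extend_apply]
    · simp [Function.extend_apply' _ _ _ hn]
  have hl' := (hasSum_extend_zero he).2 hl.hasSum
  refine ⟨Function.extend e lam 0, Function.extend e a 0, fun n => ?_, ?_, ?_, ?_⟩
  · by_cases hn : ∃ i, e i = n
    · obtain ⟨i, rfl⟩ := hn
      simpa [he.extend_apply] using ha i
    · simpa [Function.extend_apply' _ _ _ hn] using h0
  · rw [habs]; exact hl'.summable
  · rw [habs, hl'.tsum_eq]; exact hs
  · rw [hsmul]; exact (hasSum_extend_zero he).2 hg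

lemma AtomicBound.map [CompleteSpace G'] (hA' : ∀ a ∈ A', ‖a‖ ≤ 1) (T : G →L[ℝ] G') {K : ℝ}
    (hT : ∀ a ∈ A, AtomicBound A' (T a) K) {g : G} {s : ℝ} (hK : 0 ≤ K)
    (h : AtomicBound A g s) : AtomicBound A' (T g) (K * s) := by
  obtain ⟨lam, a, ha, hl, hs, hg⟩ := h
  choose m b hb hm hmK hbs using fun i => hT (a i) (ha i)
  have hsum : Summable fun p : ℕ × ℕ => |lam p.1 * m p.1 p.2| := by
    refine (summable_prod_of_nonneg fun _ => abs_nonneg _).2 ⟨fun i => ?_, ?_⟩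
    · simpa only [abs_mul] using (hm i).mul_left |lam i|
    · refine .of_nonneg_of_le (fun i => tsum_nonneg fun j => abs_nonneg _) (fun i => ?_)
        (hl.mul_right K)
      simp only [abs_mul, tsum_mul_left]
      exact mul_le_mul_of_nonneg_left (hmK i) (abs_nonneg _)
  have hval : ∑' p : ℕ × ℕ, |lam p.1 * m p.1 p.2| ≤ K * s := by
    rw [hsum.tsum_prod' fun i => by simpa only [abs_mul] using (hm i).mul_left |lam i|]
    calc ∑' i, ∑' j, |lam i * m i j| ≤ ∑' i, |lam i| * K := by
          refine Summable.tsum_le_tsum (fun i => ?_) hsum.prod (hl.mul_right K)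
          simp only [abs_mul, tsum_mul_left]
          exact mul_le_mul_of_nonneg_left (hmK i) (abs_nonneg _)
      _ ≤ K * s := by
          rw [tsum_mul_right, mul_comm]
          exact mul_le_mul_of_nonneg_left hs hK
  have hs2 := summable_smul_of_summable_abs (a := fun p : ℕ × ℕ => b p.1 p.2)
    (fun p => hA' _ (hb p.1 p.2)) hsum
  have h1 : HasSum (fun i => lam i • T (a i)) (∑' p : ℕ × ℕ, (lam p.1 * m p.1 p.2) • b p.1 p.2) := by
    refine hs2.hasSum.prod_fiberwise fun i => ?_
    simpa only [smul_smul] using (hbs i).const_smul (lam i)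
  have h2 : HasSum (fun i => lam i • T (a i)) (T g) := by
    simpa using T.hasSum hg
  rw [← h1.unique h2]
  let e := Nat.pairEquiv.symm
  refine ⟨fun n => lam (e n).1 * m (e n).1 (e n).2, fun n => b (e n).1 (e n).2,
    fun n => hb _ _, (e.summable_iff (f := fun p : ℕ × ℕ => |lam p.1 * m p.1 p.2|)).2 hsum, ?_,
    (e.hasSum_iff (f := fun p : ℕ × ℕ => (lam p.1 * m p.1 p.2) • b p.1 p.2)).2 hs2.hasSum⟩
  exact (e.tsum_eq (fun p : ℕ × ℕ => |lam p.1 * m p.1 p.2|)).trans_le hval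

lemma AtomicBound.exists_lift [CompleteSpace G] (hA : ∀ a ∈ A, ‖a‖ ≤ 1) (T : G →L[ℝ] G') {K : ℝ}
    (hK : 0 < K) (hT : ∀ b ∈ A', ∃ a ∈ A, T a = K⁻¹ • b) {g : G'} {s : ℝ}
    (h : AtomicBound A' g s) : ∃ x, T x = g ∧ AtomicBound A x (K * s) := by
  obtain ⟨lam, b, hb, hl, hs, hg⟩ := h
  choose a ha hTa using fun i => hT (b i) (hb i)
  have hl' : Summable fun i => |K * lam i| := by
    simpa only [abs_mul] using hl.mul_left |K|
  have hsum := summable_smul_of_summable_abs (fun i => hA _ (ha i)) hl'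
  refine ⟨_, ?_, _, a, ha, hl', ?_, hsum.hasSum⟩
  · refine (T.hasSum hsum.hasSum).unique ?_
    convert hg using 2 with i
    rw [map_smul, hTa, smul_smul]
    congr 1
    field_simp
  · simp only [abs_mul, tsum_mul_left, abs_of_pos hK]
    exact mul_le_mul_of_nonneg_left hs hK.le

lemma AtomicBound.mono {g : G} {s s' : ℝ} (h : AtomicBound A g s) (hs : s ≤ s') :
    AtomicBound A g s' := by
  obtain ⟨lam, a, ha, hl, hle, hg⟩ := h
  exact ⟨lam, a, ha, hl, hle.trans hs, hg⟩

lemma AtomicBound.superset {B : Set G} {g : G} {s : ℝ} (h : AtomicBound A g s) (hAB : A ⊆ B) :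
    AtomicBound B g s := by
  obtain ⟨lam, a, ha, hrest⟩ := h
  exact ⟨lam, a, fun i => hAB (ha i), hrest⟩

lemma atomicBound_of_mem {a : G} (ha : a ∈ A) : AtomicBound A a 1 := by
  have habs : HasSum (fun i : ℕ => |if i = 0 then (1 : ℝ) else 0|) 1 := by
    convert hasSum_ite_eq (0 : ℕ) (1 : ℝ) using 2 with i
    split_ifs <;> simp
  refine ⟨fun i => if i = 0 then 1 else 0, fun _ => a, fun _ => ha, habs.summable,
    habs.tsum_eq.le, ?_⟩
  simpa only [ite_smul, one_smul, zero_smul] using hasSum_ite_eq (0 : ℕ) a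

/-- Atomic sums over a union of two families of atoms split into two sums. -/
lemma AtomicBound.split_union {B : Set G} {g : G} {s : ℝ} (hA : (0 : G) ∈ A) (hB : (0 : G) ∈ B)
    (h : AtomicBound (A ∪ B) g s) :
    ∃ (lamA : ℕ → ℝ) (a : ℕ → G) (lamB : ℕ → ℝ) (b : ℕ → G), (∀ i, a i ∈ A) ∧ (∀ i, b i ∈ B) ∧
      Summable (fun i => |lamA i|) ∧ Summable (fun i => |lamB i|) ∧
      (∑' i, |lamA i|) + ∑' i, |lamB i| ≤ s ∧
      HasSum (fun i => lamA i • a i + lamB i • b i) g := by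
  classical
  obtain ⟨lam, a, ha, hl, hs, hg⟩ := h
  have hA' : Summable fun i => |if a i ∈ A then lam i else 0| :=
    .of_nonneg_of_le (fun _ => abs_nonneg _) (fun i => by split_ifs <;> simp) hl
  have hB' : Summable fun i => |if a i ∈ A then 0 else lam i| :=
    .of_nonneg_of_le (fun _ => abs_nonneg _) (fun i => by split_ifs <;> simp) hl
  refine ⟨fun i => if a i ∈ A then lam i else 0, fun i => if a i ∈ A then a i else 0,
    fun i => if a i ∈ A then 0 else lam i, fun i => if a i ∈ A then 0 else a i,
    fun i => ?_, fun i => ?_, hA', hB', ?_, ?_⟩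
  · dsimp only; split_ifs with h
    exacts [h, hA]
  · dsimp only; split_ifs with h
    exacts [hB, (ha i).resolve_left h]
  · rw [← hA'.tsum_add hB']
    refine le_trans (le_of_eq (tsum_congr fun i => ?_)) hs
    split_ifs <;> simp
  · convert hg using 2 with i
    dsimp only
    split_ifs <;> simp

lemma AtomicBound.union [CompleteSpace G] {B : Set G} (hA : ∀ a ∈ A, ‖a‖ ≤ 1)
    (hB : ∀ b ∈ B, ‖b‖ ≤ 1) {g : G} {lamA lamB : ℕ → ℝ} {a b : ℕ → G}
    (ha : ∀ i, a i ∈ A) (hb : ∀ i, b i ∈ B) (hlA : Summable fun i => |lamA i|)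
    (hlB : Summable fun i => |lamB i|)
    (hg : Tendsto (fun k => ∑ i ∈ Finset.range k, lamA i • a i
      + ∑ i ∈ Finset.range k, lamB i • b i) atTop (nhds g)) :
    AtomicBound (A ∪ B) g ((∑' i, |lamA i|) + ∑' i, |lamB i|) := by
  have hsA := (summable_smul_of_summable_abs (fun i => hA _ (ha i)) hlA).hasSum
  have hsB := (summable_smul_of_summable_abs (fun i => hB _ (hb i)) hlB).hasSum
  have := tendsto_nhds_unique hg (hsA.tendsto_sum_nat.add hsB.tendsto_sum_nat)
  subst this
  let e := Equiv.natSumNatEquivNat.symm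
  let L : ℕ ⊕ ℕ → ℝ := Sum.elim lamA lamB
  let x : ℕ ⊕ ℕ → G := Sum.elim a b
  have h1 : HasSum (fun i => |L i|) ((∑' i, |lamA i|) + ∑' i, |lamB i|) :=
    HasSum.sum (f := fun i => |L i|) hlA.hasSum hlB.hasSum
  have h2 : HasSum (fun i => L i • x i) ((∑' i, lamA i • a i) + ∑' i, lamB i • b i) :=
    HasSum.sum (f := fun i => L i • x i) hsA hsB
  have hx : ∀ j, x j ∈ A ∪ B := by
    rintro (i | i)
    exacts [Or.inl (ha i), Or.inr (hb i)]
  refine ⟨fun n => L (e n), fun n => x (e n), fun n => hx _, ?_, ?_, ?_⟩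
  · exact (e.summable_iff (f := fun i => |L i|)).2 h1.summable
  · exact ((e.tsum_eq (fun i => |L i|)).trans h1.tsum_eq).le
  · exact (e.hasSum_iff (f := fun i => L i • x i)).2 h2

end Atomic

section L1

variable {α : Type*} [MeasurableSpace α] {ρ : Measure α}

lemma toL1_finset_sum {ι : Type*} (s : Finset ι) {g : ι → α → ℝ} (hg : ∀ i, Integrable (g i) ρ)
    (h : Integrable (fun p => ∑ i ∈ s, g i p) ρ) : h.toL1 = ∑ i ∈ s, (hg i).toL1 := by
  classical
  induction s using Finset.induction_on with
  | empty => exact Integrable.toL1_zero _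
  | insert k s hk ih =>
    have hs : Integrable (fun p => ∑ i ∈ s, g i p) ρ := integrable_finsetSum _ fun i _ => hg i
    rw [Finset.sum_insert hk, ← ih hs, ← Integrable.toL1_add]
    exact (Integrable.toL1_eq_toL1_iff _ _ _ _).2 (.of_forall fun p => by
      simp [Finset.sum_insert hk])

lemma toL1_sum_smul {a : ℕ → α → ℝ} (ha : ∀ i, Integrable (a i) ρ) (lam : ℕ → ℝ) (k : ℕ)
    (h : Integrable (fun p => ∑ i ∈ Finset.range k, lam i * a i p) ρ) :
    h.toL1 = ∑ i ∈ Finset.range k, lam i • (ha i).toL1 := by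
  rw [toL1_finset_sum _ (fun i => (ha i).const_mul (lam i)) h]
  exact Finset.sum_congr rfl fun i _ => Integrable.toL1_smul (a i) (ha i) (lam i)

lemma tendsto_toL1_iff {f : α → ℝ} (hf : Integrable f ρ) {g : ℕ → α → ℝ}
    (hg : ∀ k, Integrable (g k) ρ) :
    Tendsto (fun k => eLpNorm (fun p => f p - g k p) 1 ρ) atTop (nhds 0) ↔
      Tendsto (fun k => (hg k).toL1) atTop (nhds hf.toL1) := by
  rw [tendsto_iff_edist_tendsto_0]
  refine tendsto_congr fun k => ?_
  rw [edist_comm, Integrable.toL1, Integrable.toL1, Lp.edist_toLp_toLp]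
  rfl

lemma integrable_range_sum {a : ℕ → α → ℝ} (ha : ∀ i, Integrable (a i) ρ) (lam : ℕ → ℝ) (k : ℕ) :
    Integrable (fun p => ∑ i ∈ Finset.range k, lam i * a i p) ρ :=
  integrable_finsetSum _ fun i _ => (ha i).const_mul _

lemma hasSum_toL1_indicator {ι : Type*} [Countable ι] {a : α → ℝ} (ha : Integrable a ρ)
    {P : ι → Set α} (hP : ∀ i, MeasurableSet (P i)) (hd : Pairwise (Function.onFun Disjoint P))
    (h0 : ∀ᵐ p ∂ρ, p ∉ ⋃ i, P i → a p = 0) :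
    HasSum (fun i => (ha.indicator (hP i)).toL1) ha.toL1 := by
  classical
  rw [HasSum, tendsto_iff_norm_sub_tendsto_zero]
  have hsumint (F : Finset ι) : Integrable (fun p => ∑ i ∈ F, (P i).indicator a p) ρ :=
    integrable_finsetSum _ fun i _ => ha.indicator (hP i)
  have hpt (F : Finset ι) (p : α) :
      ‖∑ i ∈ F, (P i).indicator a p - a p‖ = ‖a p‖ - ∑ i ∈ F, (P i).indicator (fun p => ‖a p‖) p := by
    by_cases h : ∃ i ∈ F, p ∈ P i
    · obtain ⟨i, hi, hp⟩ := h
      have hne (j : ι) (hj : j ≠ i) : p ∉ P j := fun hpj => (hd hj).le_bot ⟨hpj, hp⟩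
      rw [Finset.sum_eq_single_of_mem i hi fun j _ hj => indicator_of_notMem (hne j hj) _,
        Finset.sum_eq_single_of_mem i hi fun j _ hj => indicator_of_notMem (hne j hj) _,
        indicator_of_mem hp, indicator_of_mem hp]
      simp
    · push Not at h
      rw [Finset.sum_eq_zero fun j hj => indicator_of_notMem (h j hj) _,
        Finset.sum_eq_zero fun j hj => indicator_of_notMem (h j hj) _]
      simp
  have hnorm (F : Finset ι) : ‖∑ i ∈ F, (ha.indicator (hP i)).toL1 - ha.toL1‖
      = ∫ p, ‖a p‖ ∂ρ - ∑ i ∈ F, ∫ p in P i, ‖a p‖ ∂ρ := by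
    rw [← toL1_finset_sum F (fun i => ha.indicator (hP i)) (hsumint F), ← Integrable.toL1_sub,
      L1.norm_of_fun_eq_integral_norm]
    simp only [Pi.sub_apply, hpt]
    rw [integral_sub ha.norm (integrable_finsetSum _ fun i _ => ha.norm.indicator (hP i)),
      integral_finsetSum _ fun i _ => ha.norm.indicator (hP i)]
    simp only [integral_indicator (hP _)]
  have hs := hasSum_integral_iUnion hP hd ha.norm.integrableOn
  have hU : ∫ p in ⋃ i, P i, ‖a p‖ ∂ρ = ∫ p, ‖a p‖ ∂ρ := by
    refine setIntegral_eq_integral_of_ae_compl_eq_zero ?_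
    filter_upwards [h0] with p hp hpU
    simp [hp hpU]
  rw [hU] at hs
  simp only [hnorm]
  simpa only [sub_self] using (tendsto_const_nhds (x := ∫ p, ‖a p‖ ∂ρ)).sub hs

lemma exists_disjoint_refinement {ι : Type*} [Countable ι] {S : ι → Set α}
    (hS : ∀ i, MeasurableSet (S i)) :
    ∃ P : ι → Set α, (∀ i, MeasurableSet (P i)) ∧ (∀ i, P i ⊆ S i) ∧
      Pairwise (Function.onFun Disjoint P) ∧ ⋃ i, S i ⊆ ⋃ i, P i := by
  obtain ⟨e, he⟩ := exists_injective_nat ι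
  refine ⟨fun i => S i \ ⋃ j, ⋃ _ : e j < e i, S j, fun i => ?_, fun i => sdiff_subset, ?_, ?_⟩
  · exact (hS i).diff (.iUnion fun j => .iUnion fun _ => hS j)
  · intro i j hij
    refine disjoint_left.2 fun p hpi hpj => ?_
    rcases lt_or_gt_of_ne (he.ne hij) with h | h
    · exact hpj.2 (mem_iUnion₂.2 ⟨i, h, hpi.1⟩)
    · exact hpi.2 (mem_iUnion₂.2 ⟨j, h, hpj.1⟩)
  · intro p hp
    obtain ⟨i, hi, hmin⟩ : ∃ i, p ∈ S i ∧ ∀ j, p ∈ S j → e i ≤ e j := by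
      obtain ⟨i, hi, hmin⟩ := (InvImage.wf e Nat.lt_wfRel.wf).has_min {i | p ∈ S i}
        (mem_iUnion.1 hp)
      exact ⟨i, hi, fun j hj => not_lt.1 (hmin j hj)⟩
    exact mem_iUnion.2 ⟨i, hi, fun h => by
      obtain ⟨j, hj, hpj⟩ := mem_iUnion₂.1 h
      exact (hmin j hpj).not_gt hj⟩

end L1

lemma measurableSet_Xset {E : Type*} [MeasurableSpace E] : MeasurableSet (Xset E) :=
  measurableSet_lt measurable_const measurable_fst

section Parabolic

variable {E : Type*} [MetricSpace E]

lemma pball_eq (c : ℝ × E) {r : ℝ} (hr : 0 < r) :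
    pball c r = Ioo (c.1 - r ^ 2) (c.1 + r ^ 2) ×ˢ ball c.2 r := by
  ext p
  simp only [pball, pdist, Set.mem_ofPred_eq, max_lt_iff, Real.sqrt_lt' hr, abs_lt, mem_prod,
    mem_Ioo, mem_ball]
  constructor <;> rintro ⟨⟨h1, h2⟩, h3⟩ <;> exact ⟨⟨by linarith, by linarith⟩, h3⟩

lemma mem_pball_iff {c p : ℝ × E} {r : ℝ} (hr : 0 < r) :
    p ∈ pball c r ↔ |p.1 - c.1| < r ^ 2 ∧ dist p.2 c.2 < r := by
  simp only [pball, pdist, Set.mem_ofPred_eq, max_lt_iff, Real.sqrt_lt' hr]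

lemma mem_pball_self (c : ℝ × E) {r : ℝ} (hr : 0 < r) : c ∈ pball c r :=
  (mem_pball_iff hr).2 ⟨by simpa using pow_pos hr 2, by simpa using hr⟩

lemma pball_mono (c : ℝ × E) {r s : ℝ} (h : r ≤ s) : pball c r ⊆ pball c s :=
  fun _ hp => lt_of_lt_of_le hp h

lemma pdist_comm (p q : ℝ × E) : pdist p q = pdist q p := by
  rw [pdist, pdist, abs_sub_comm, dist_comm]

lemma pdist_triangle (p m q : ℝ × E) : pdist p q ≤ pdist p m + pdist m q := by
  refine max_le ?_ ?_
  · calc √|p.1 - q.1| ≤ √(|p.1 - m.1| + |m.1 - q.1|) := Real.sqrt_le_sqrt (abs_sub_le _ _ _)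
      _ ≤ √|p.1 - m.1| + √|m.1 - q.1| := by
          rw [Real.sqrt_le_left (by positivity), add_sq, Real.sq_sqrt (abs_nonneg _),
            Real.sq_sqrt (abs_nonneg _)]
          nlinarith [Real.sqrt_nonneg |p.1 - m.1|, Real.sqrt_nonneg |m.1 - q.1|,
            mul_nonneg (Real.sqrt_nonneg |p.1 - m.1|) (Real.sqrt_nonneg |m.1 - q.1|)]
      _ ≤ _ := add_le_add (le_max_left _ _) (le_max_left _ _)
  · exact (dist_triangle _ _ _).trans (add_le_add (le_max_right _ _) (le_max_right _ _))

lemma pball_subset_Xset_iff (c : ℝ × E) {r : ℝ} (hr : 0 < r) :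
    pball c r ⊆ Xset E ↔ r ^ 2 ≤ c.1 := by
  constructor
  · intro h
    by_contra! hc
    by_cases h0 : 0 < c.1
    · have : ((0 : ℝ), c.2) ∈ pball c r :=
        (mem_pball_iff hr).2 ⟨by simpa [abs_of_pos h0] using hc, by simpa using hr⟩
      have h00 : (0 : ℝ) < 0 := h this
      exact lt_irrefl _ h00
    · exact h0 (h (mem_pball_self c hr))
  · intro h p hp
    have := (abs_lt.1 ((mem_pball_iff hr).1 hp).1).1
    simp only [Xset, Set.mem_ofPred_eq]
    linarith

variable [MeasurableSpace E]

lemma measurableSet_pball [OpensMeasurableSpace E] (c : ℝ × E) {r : ℝ} (hr : 0 < r) :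
    MeasurableSet (pball c r) := by
  rw [pball_eq c hr]
  exact measurableSet_Ioo.prod measurableSet_ball

variable {μ : Measure E} {D : ℝ}

lemma DoublingWith.sigmaFinite (h : DoublingWith μ D) : SigmaFinite μ := by
  rcases isEmpty_or_nonempty E with hE | ⟨⟨x⟩⟩
  · rw [Measure.eq_zero_of_isEmpty μ]
    infer_instance
  · refine ⟨⟨⟨fun n => ball x (n + 1), fun _ => trivial, fun n => (h.1 x _ (by positivity)).2, ?_⟩⟩⟩
    refine eq_univ_of_forall fun y => mem_iUnion.2 ?_
    obtain ⟨n, hn⟩ := exists_nat_gt (dist y x)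
    exact ⟨n, mem_ball.2 (hn.trans (lt_add_one _))⟩

lemma DoublingWith.pmeas_pball (h : DoublingWith μ D) (c : ℝ × E) {r : ℝ} (hr : 0 < r) :
    pmeas μ (pball c r) = ENNReal.ofReal (2 * r ^ 2) * μ (ball c.2 r) := by
  have := h.sigmaFinite
  rw [pball_eq c hr, pmeas, Measure.prod_prod, Real.volume_Ioo]
  congr 2
  ring

lemma DoublingWith.pmeas_pball_pos (h : DoublingWith μ D) (c : ℝ × E) {r : ℝ} (hr : 0 < r) :
    0 < pmeas μ (pball c r) := by
  rw [h.pmeas_pball c hr]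
  exact ENNReal.mul_pos (by simpa using hr.ne') (h.1 _ r hr).1.ne'

lemma DoublingWith.pmeas_pball_ne_top (h : DoublingWith μ D) (c : ℝ × E) {r : ℝ} (hr : 0 < r) :
    pmeas μ (pball c r) ≠ ⊤ := by
  rw [h.pmeas_pball c hr]
  exact ENNReal.mul_ne_top ENNReal.ofReal_ne_top (h.1 _ r hr).2.ne

lemma DoublingWith.pmeas_pball_two_mul_le (h : DoublingWith μ D) (c : ℝ × E) {r : ℝ}
    (hr : 0 < r) :
    pmeas μ (pball c (2 * r)) ≤ ENNReal.ofReal (4 * D) * pmeas μ (pball c r) := by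
  rw [h.pmeas_pball c hr, h.pmeas_pball c (by positivity : 0 < 2 * r)]
  calc _ ≤ ENNReal.ofReal (2 * (2 * r) ^ 2) * (ENNReal.ofReal D * μ (ball c.2 r)) := by
        gcongr
        exact h.2 _ _ hr
    _ = _ := by
        rw [show 2 * (2 * r) ^ 2 = 4 * (2 * r ^ 2) by ring, ENNReal.ofReal_mul (by norm_num),
          ENNReal.ofReal_mul (p := 4) (by norm_num)]
        ring

lemma rpow_neg_half_eq (W : ENNReal) : W ^ (-(1 : ℝ) / 2) = (W⁻¹) ^ ((1 : ℝ) / 2) := by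
  rw [ENNReal.inv_rpow, ← ENNReal.rpow_neg, neg_div]

lemma eLpNorm_two_le_iff {α : Type*} [MeasurableSpace α] {ρ : Measure α} (a : α → ℝ)
    (W : ENNReal) :
    eLpNorm a 2 ρ ≤ W ^ (-(1 : ℝ) / 2) ↔ ∫⁻ p, ‖a p‖ₑ ^ 2 ∂ρ ≤ W⁻¹ := by
  rw [rpow_neg_half_eq, eLpNorm_eq_lintegral_rpow_enorm_toReal (by norm_num) (by norm_num)]
  simp only [ENNReal.toReal_ofNat, ENNReal.rpow_ofNat]
  exact ENNReal.rpow_le_rpow_iff (by norm_num)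

lemma eLpNorm_one_le_one_of_support {α : Type*} [MeasurableSpace α] {ρ : Measure α} {a : α → ℝ}
    (ha : AEStronglyMeasurable a ρ) {Q : Set α} (h0 : ρ Q ≠ 0)
    (htop : ρ Q ≠ ⊤) (hs : Function.support a ⊆ Q)
    (hle : eLpNorm a 2 ρ ≤ ρ Q ^ (-(1 : ℝ) / 2)) : eLpNorm a 1 ρ ≤ 1 := by
  have h := eLpNorm_le_eLpNorm_mul_rpow_measure_univ (μ := ρ.restrict Q) (p := 1) (q := 2)
    (by norm_num) ha.restrict
  rw [eLpNorm_restrict_eq_of_support_subset hs, eLpNorm_restrict_eq_of_support_subset hs,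
    Measure.restrict_apply_univ] at h
  calc eLpNorm a 1 ρ ≤ _ := h
    _ ≤ ρ Q ^ (-(1 : ℝ) / 2) * ρ Q ^ (1 / (1 : ENNReal).toReal - 1 / (2 : ENNReal).toReal) := by
        gcongr
    _ = 1 := by
        rw [← ENNReal.rpow_add _ _ h0 htop]
        norm_num

end Parabolic

lemma norm_le_one_of_ae {α : Type*} [MeasurableSpace α] {ρ : Measure α} {g : Lp ℝ 1 ρ} {a : α → ℝ}
    (h : g =ᵐ[ρ] a) (ha : eLpNorm a 1 ρ ≤ 1) : ‖g‖ ≤ 1 := by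
  rw [Lp.norm_def, eLpNorm_congr_ae h]
  exact ENNReal.toReal_le_of_le_ofReal zero_le_one (by simpa using ha)

section Hardy

variable {E : Type*} [MeasurableSpace E] {μ : Measure E} {D : ℝ}

/-- Restriction from `L¹(N)` to `L¹(X)`. -/
def restrictX (μ : Measure E) : Lp ℝ 1 (pmeas μ) →L[ℝ] Lp ℝ 1 ((pmeas μ).restrict (Xset E)) :=
  LpToLpRestrictCLM (ℝ × E) ℝ ℝ (pmeas μ) 1 (Xset E)

lemma restrictX_ae (g : Lp ℝ 1 (pmeas μ)) :
    restrictX μ g =ᵐ[(pmeas μ).restrict (Xset E)] g :=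
  LpToLpRestrictCLM_coeFn ℝ (Xset E) g

variable [MetricSpace E]

lemma IsTypeAAtom.isAtom12 {a : ℝ × E → ℝ} (h : IsTypeAAtom μ a) : IsAtom12 μ a := by
  obtain ⟨c, r, hr, hs, -, hi, h0, hle⟩ := h
  exact ⟨c, r, hr, hs, hi, h0, hle⟩

lemma IsAtom12.integrable {a : ℝ × E → ℝ} (h : IsAtom12 μ a) : Integrable a (pmeas μ) := by
  obtain ⟨c, r, hr, hs, hi, -⟩ := h
  exact hi

lemma IsTypeBAtom.integrable {a : ℝ × E → ℝ} (h : IsTypeBAtom μ a) : Integrable a (pmeas μ) := by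
  obtain ⟨c, r, hr, hs, -, -, hi, -⟩ := h
  exact hi

lemma IsAtom12.eLpNorm_le_one (hμ : DoublingWith μ D) {a : ℝ × E → ℝ} (h : IsAtom12 μ a) :
    eLpNorm a 1 (pmeas μ) ≤ 1 := by
  obtain ⟨c, r, hr, hs, hi, -, hle⟩ := h
  exact eLpNorm_one_le_one_of_support hi.1 (hμ.pmeas_pball_pos c hr).ne'
    (hμ.pmeas_pball_ne_top c hr) hs hle

lemma IsTypeBAtom.eLpNorm_le_one (hμ : DoublingWith μ D) {a : ℝ × E → ℝ} (h : IsTypeBAtom μ a) :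
    eLpNorm a 1 (pmeas μ) ≤ 1 := by
  obtain ⟨c, r, hr, hs, -, -, hi, hle⟩ := h
  exact eLpNorm_one_le_one_of_support hi.1 (hμ.pmeas_pball_pos c hr).ne'
    (hμ.pmeas_pball_ne_top c hr) hs hle

lemma isTypeAAtom_zero (x : E) : IsTypeAAtom μ (0 : ℝ × E → ℝ) :=
  ⟨(16, x), 1, one_pos, by simp, (pball_subset_Xset_iff _ (by norm_num)).2 (by norm_num),
    integrable_zero _ _ _, by simp, by simp⟩

lemma isTypeBAtom_zero (x : E) : IsTypeBAtom μ (0 : ℝ × E → ℝ) :=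
  ⟨(4, x), 1, one_pos, by simp, (pball_subset_Xset_iff _ (by norm_num)).2 (by norm_num),
    fun h => absurd ((pball_subset_Xset_iff _ (by norm_num)).1 h) (by norm_num),
    integrable_zero _ _ _, by simp⟩

lemma IsAtom12.const_mul {a : ℝ × E → ℝ} (h : IsAtom12 μ a) {t : ℝ} (ht : |t| ≤ 1) :
    IsAtom12 μ (fun p => t * a p) := by
  obtain ⟨c, r, hr, hs, hi, h0, hle⟩ := h
  refine ⟨c, r, hr, fun p hp => hs fun h => hp (by simp [h]), hi.const_mul t, ?_, ?_⟩
  · rw [integral_const_mul, h0, mul_zero]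
  · refine le_trans (eLpNorm_mono fun p => ?_) hle
    rw [norm_mul, Real.norm_eq_abs]
    exact mul_le_of_le_one_left (norm_nonneg _) ht

/-- Classes in `L¹(N)` of `(1,2)`-atoms. -/
def atomSet (μ : Measure E) : Set (Lp ℝ 1 (pmeas μ)) :=
  {g | ∃ a, IsAtom12 μ a ∧ g =ᵐ[pmeas μ] a}

/-- Classes in `L¹(X)` of type (a) atoms. -/
def typeASet (μ : Measure E) : Set (Lp ℝ 1 ((pmeas μ).restrict (Xset E))) :=
  {g | ∃ a, IsTypeAAtom μ a ∧ g =ᵐ[(pmeas μ).restrict (Xset E)] a}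

/-- Classes in `L¹(X)` of type (b) atoms. -/
def typeBSet (μ : Measure E) : Set (Lp ℝ 1 ((pmeas μ).restrict (Xset E))) :=
  {g | ∃ b, IsTypeBAtom μ b ∧ g =ᵐ[(pmeas μ).restrict (Xset E)] b}

lemma norm_le_one_of_mem_atomSet (hμ : DoublingWith μ D) : ∀ g ∈ atomSet μ, ‖g‖ ≤ 1 := by
  rintro g ⟨a, ha, hg⟩
  exact norm_le_one_of_ae hg (ha.eLpNorm_le_one hμ)

lemma norm_le_one_of_mem_typeASet (hμ : DoublingWith μ D) : ∀ g ∈ typeASet μ, ‖g‖ ≤ 1 := by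
  rintro g ⟨a, ha, hg⟩
  exact norm_le_one_of_ae hg
    ((eLpNorm_restrict_le _ _ _ _).trans (ha.isAtom12.eLpNorm_le_one hμ))

lemma norm_le_one_of_mem_typeBSet (hμ : DoublingWith μ D) : ∀ g ∈ typeBSet μ, ‖g‖ ≤ 1 := by
  rintro g ⟨a, ha, hg⟩
  exact norm_le_one_of_ae hg ((eLpNorm_restrict_le _ _ _ _).trans (ha.eLpNorm_le_one hμ))

lemma zero_mem_typeASet (x : E) : 0 ∈ typeASet μ := ⟨0, isTypeAAtom_zero x, Lp.coeFn_zero _ _ _⟩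

lemma zero_mem_typeBSet (x : E) : 0 ∈ typeBSet μ := ⟨0, isTypeBAtom_zero x, Lp.coeFn_zero _ _ _⟩

/-- The Whitney-type covering of the part of a parabolic ball lying in `X`. -/
lemma exists_whitney_cover [BorelSpace E] (hμ : DoublingWith μ D) (c : ℝ × E) {r : ℝ}
    (hr : 0 < r) (hc : c.1 < 16 * r ^ 2) :
    ∃ u : Set (ℝ × E), u.Countable ∧ (∀ q ∈ u, 0 < q.1) ∧
      pball c r ∩ Xset E ⊆ ⋃ q : u, pball q.1 (√q.1.1 / 2) ∧
      ∑' q : u, pmeas μ (pball q.1 (√q.1.1 / 2))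
        ≤ ENNReal.ofReal (4 * D) ^ 3 * pmeas μ (pball c r) := by
  have hρ {q : ℝ × E} (hq : q ∈ pball c r ∩ Xset E) : 0 < √q.1 / 6 ∧ √q.1 / 6 ≤ r := by
    have h0 : 0 < q.1 := hq.2
    have h1 := (abs_lt.1 ((mem_pball_iff hr).1 hq.1).1).2
    have h2 : √q.1 ≤ 6 * r := by
      rw [Real.sqrt_le_left (by positivity)]
      nlinarith
    exact ⟨by positivity, by linarith⟩
  obtain ⟨u, hut, hdisj, hcov⟩ := Vitali.exists_disjoint_subfamily_covering_enlargement
    (fun q : ℝ × E => pball q (√q.1 / 6)) (pball c r ∩ Xset E) (fun q => √q.1 / 6) 2 one_lt_two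
    (fun q hq => (hρ hq).1.le) r (fun q hq => (hρ hq).2) fun q hq => ⟨q, mem_pball_self q (hρ hq).1⟩
  have hsmall : ∑' q : u, pmeas μ (pball q.1 (√q.1.1 / 6))
      ≤ ENNReal.ofReal (4 * D) * pmeas μ (pball c r) := by
    refine (tsum_meas_le_meas_iUnion_of_disjoint (pmeas μ)
      (fun q : u => measurableSet_pball q.1 (hρ (hut q.2)).1)
      fun p q hpq => hdisj p.2 q.2 (Subtype.coe_injective.ne hpq)).trans ?_
    refine (measure_mono (iUnion_subset fun q p hp => ?_)).trans
      (hμ.pmeas_pball_two_mul_le c hr)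
    have h1 : pdist p q.1 < √q.1.1 / 6 := hp
    have h2 : pdist q.1 c < r := (hut q.2).1
    have h3 := pdist_triangle p q.1 c
    have h4 := (hρ (hut q.2)).2
    exact show pdist p c < 2 * r by linarith
  refine ⟨u, ?_, fun q hq => (hut hq).2, ?_, ?_⟩
  · have htop : ∑' q : u, pmeas μ (pball q.1 (√q.1.1 / 6)) ≠ ⊤ :=
      ne_top_of_le_ne_top (ENNReal.mul_ne_top ENNReal.ofReal_ne_top
        (hμ.pmeas_pball_ne_top c hr)) hsmall
    have hsupp := Summable.countable_support_ennreal htop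
    rw [Function.support_eq_univ fun q : u => (hμ.pmeas_pball_pos q.1 (hρ (hut q.2)).1).ne'] at hsupp
    exact countable_coe_iff.1 (countable_univ_iff.1 hsupp)
  · intro p hp
    obtain ⟨q, hq, ⟨z, hzp, hzq⟩, hle⟩ := hcov p hp
    refine mem_iUnion.2 ⟨⟨q, hq⟩, ?_⟩
    have h1 : pdist z p < √p.1 / 6 := hzp
    have h2 : pdist z q < √q.1 / 6 := hzq
    have h3 := pdist_triangle p z q
    rw [pdist_comm p z] at h3
    exact show pdist p q < √q.1 / 2 by linarith
  · have hbig (q : u) : pmeas μ (pball q.1 (√q.1.1 / 2))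
        ≤ ENNReal.ofReal (4 * D) ^ 2 * pmeas μ (pball q.1 (√q.1.1 / 6)) := by
      have h0 := (hρ (hut q.2)).1
      calc _ ≤ pmeas μ (pball q.1 (2 * (2 * (√q.1.1 / 6)))) :=
            measure_mono (pball_mono _ (by linarith))
        _ ≤ _ := hμ.pmeas_pball_two_mul_le _ (by positivity)
        _ ≤ ENNReal.ofReal (4 * D) * (ENNReal.ofReal (4 * D) * _) := by
            gcongr
            exact hμ.pmeas_pball_two_mul_le _ h0
        _ = _ := by ring
    calc _ ≤ ∑' q : u, ENNReal.ofReal (4 * D) ^ 2 * pmeas μ (pball q.1 (√q.1.1 / 6)) :=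
          ENNReal.tsum_le_tsum hbig
      _ ≤ ENNReal.ofReal (4 * D) ^ 2 * (ENNReal.ofReal (4 * D) * pmeas μ (pball c r)) := by
          rw [ENNReal.tsum_mul_left]
          gcongr
      _ = _ := by ring

lemma atomicBound_restrictX_of_not_subset [BorelSpace E] (hμ : DoublingWith μ D) (hD : 1 ≤ D)
    {a : ℝ × E → ℝ} {c : ℝ × E} {r : ℝ} (hr : 0 < r) (hs : Function.support a ⊆ pball c r)
    (ha : Integrable a (pmeas μ))
    (hle : eLpNorm a 2 (pmeas μ) ≤ (pmeas μ (pball c r)) ^ (-(1 : ℝ) / 2))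
    (hc : c.1 < 16 * r ^ 2) {g : Lp ℝ 1 (pmeas μ)} (hg : g =ᵐ[pmeas μ] a) :
    AtomicBound (typeBSet μ) (restrictX μ g) (1 + (4 * D) ^ 3) := by
  obtain ⟨u, hu, hupos, hcov, hsum⟩ := exists_whitney_cover hμ c hr hc
  have := hu.to_subtype
  have hrad (q : u) : 0 < √q.1.1 / 2 := by have := hupos _ q.2; positivity
  obtain ⟨P, hPm, hPS, hPd, hPU⟩ := exists_disjoint_refinement
    (S := fun q : u => pball q.1 (√q.1.1 / 2)) fun q => measurableSet_pball q.1 (hrad q)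
  set W := pmeas μ (pball c r)
  have hW0 : W ≠ 0 := (hμ.pmeas_pball_pos c hr).ne'
  have hWtop : W ≠ ⊤ := hμ.pmeas_pball_ne_top c hr
  have ha2 := (eLpNorm_two_le_iff a W).1 hle
  let V : u → ENNReal := fun q => pmeas μ (pball q.1 (√q.1.1 / 2))
  have hV0 (q : u) : V q ≠ 0 := (hμ.pmeas_pball_pos _ (hrad q)).ne'
  have hVtop (q : u) : V q ≠ ⊤ := hμ.pmeas_pball_ne_top _ (hrad q)
  let I : u → ENNReal := fun q => ∫⁻ p in P q, ‖a p‖ₑ ^ 2 ∂pmeas μ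
  have hIsum : ∑' q, I q ≤ W⁻¹ := by
    rw [← lintegral_iUnion hPm hPd]
    exact (setLIntegral_le_lintegral _ _).trans ha2
  -- The coefficients dominate the geometric means of `W * I q` and `V q / W`
  let L : u → ENNReal := fun q => W * I q + V q / W
  have hLsum : ∑' q, L q ≤ ENNReal.ofReal (1 + (4 * D) ^ 3) := by
    rw [ENNReal.tsum_add, ENNReal.tsum_mul_left]
    simp only [div_eq_mul_inv]
    rw [ENNReal.tsum_mul_right, ENNReal.ofReal_add zero_le_one (by positivity),
      ENNReal.ofReal_one, ENNReal.ofReal_pow (by positivity)]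
    gcongr
    · calc W * ∑' q, I q ≤ W * W⁻¹ := by gcongr
        _ = 1 := ENNReal.mul_inv_cancel hW0 hWtop
    · calc (∑' q, V q) * W⁻¹ ≤ ENNReal.ofReal (4 * D) ^ 3 * W * W⁻¹ := by gcongr
        _ = _ := by rw [mul_assoc, ENNReal.mul_inv_cancel hW0 hWtop, mul_one]
  have hLsumtop : ∑' q, L q ≠ ⊤ := ne_top_of_le_ne_top ENNReal.ofReal_ne_top hLsum
  have hLtop (q : u) : L q ≠ ⊤ := ENNReal.ne_top_of_tsum_ne_top hLsumtop q
  have hL0 (q : u) : L q ≠ 0 := fun h =>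
    (ENNReal.div_pos (hV0 q) hWtop).ne' (add_eq_zero.1 h).2
  have hIV (q : u) : I q * V q ≤ L q ^ 2 := by
    calc I q * V q = (W * I q) * (V q / W) := by
          rw [div_eq_mul_inv, mul_comm W, mul_assoc, ← mul_assoc W, mul_comm W, mul_assoc (V q),
            ENNReal.mul_inv_cancel hW0 hWtop, mul_one]
      _ ≤ L q * L q := mul_le_mul' le_self_add le_add_self
      _ = L q ^ 2 := (sq _).symm
  let lam : u → ℝ := fun q => (L q).toReal
  have hlam (q : u) : 0 < lam q := ENNReal.toReal_pos (hL0 q) (hLtop q)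
  let b : u → ℝ × E → ℝ := fun q => (lam q)⁻¹ • (P q).indicator a
  have hbint (q : u) : Integrable (b q) (pmeas μ) := (ha.indicator (hPm q)).smul _
  have hbatom (q : u) : IsTypeBAtom μ (b q) := by
    have hq := (hupos _ q.2)
    refine ⟨q.1, √q.1.1 / 2, hrad q, ?_, ?_, ?_, hbint q, ?_⟩
    · exact (Function.support_const_smul_subset _ _).trans
        (support_indicator_subset.trans (hPS q))
    · rw [pball_subset_Xset_iff _ (by positivity), mul_div_cancel₀ _ two_ne_zero,
        Real.sq_sqrt hq.le]
    · rw [pball_subset_Xset_iff _ (by positivity), mul_pow, div_pow, Real.sq_sqrt hq.le]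
      linarith
    · rw [eLpNorm_two_le_iff]
      have hpt (p : ℝ × E) : ‖b q p‖ₑ ^ 2
          = (L q)⁻¹ ^ 2 * (P q).indicator (fun p => ‖a p‖ₑ ^ 2) p := by
        have hn : ‖(lam q)⁻¹‖ₑ = (L q)⁻¹ := by
          rw [enorm_inv (hlam q).ne', Real.enorm_of_nonneg (hlam q).le,
            ENNReal.ofReal_toReal (hLtop q)]
        simp only [b, Pi.smul_apply, smul_eq_mul, enorm_mul, mul_pow, hn]
        by_cases hp : p ∈ P q <;> simp [hp]
      simp only [hpt]
      rw [lintegral_const_mul' _ _ (by simp [hL0 q]), lintegral_indicator (hPm q),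
        ENNReal.le_inv_iff_mul_le]
      calc (L q)⁻¹ ^ 2 * I q * V q ≤ (L q)⁻¹ ^ 2 * L q ^ 2 := by
            rw [mul_assoc]
            gcongr
            exact hIV q
        _ = 1 := by rw [← mul_pow, ENNReal.inv_mul_cancel (hL0 q) (hLtop q), one_pow]
  have habs (q : u) : |lam q| = (L q).toReal := abs_of_pos (hlam q)
  have haX : Integrable a ((pmeas μ).restrict (Xset E)) := ha.restrict
  have hTg : restrictX μ g = haX.toL1 := by
    have hgX : g =ᵐ[(pmeas μ).restrict (Xset E)] a := ae_restrict_of_ae hg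
    exact Lp.ext ((restrictX_ae g).trans (hgX.trans haX.coeFn_toL1.symm))
  refine atomicBound_of_countable (zero_mem_typeBSet c.2) (lam := lam)
    (a := fun q => (hbint q).restrict.toL1) (fun q => ⟨b q, hbatom q, Integrable.coeFn_toL1 _⟩)
    ?_ ?_ ?_
  · simp only [habs]
    exact ENNReal.summable_toReal hLsumtop
  · simp only [habs]
    rw [← ENNReal.tsum_toReal_eq hLtop]
    exact ENNReal.toReal_le_of_le_ofReal (by positivity) hLsum
  · rw [hTg]
    convert hasSum_toL1_indicator haX hPm hPd ?_ using 2 with q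
    · rw [← Integrable.toL1_smul']
      refine (Integrable.toL1_eq_toL1_iff _ _ _ _).2 (.of_forall fun p => ?_)
      simp [b, (hlam q).ne']
    · filter_upwards [ae_restrict_mem measurableSet_Xset] with p hpX hpU
      by_contra hap
      exact hpU (hPU (hcov ⟨hs hap, hpX⟩))

lemma atomicBound_restrictX [BorelSpace E] (hμ : DoublingWith μ D) (hD : 1 ≤ D)
    {g : Lp ℝ 1 (pmeas μ)} (hg : g ∈ atomSet μ) :
    AtomicBound (typeASet μ ∪ typeBSet μ) (restrictX μ g) (1 + (4 * D) ^ 3) := by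
  obtain ⟨a, ⟨c, r, hr, hs, hi, h0, hle⟩, hga⟩ := hg
  rcases lt_or_ge c.1 (16 * r ^ 2) with hc | hc
  · exact (atomicBound_restrictX_of_not_subset hμ hD hr hs hi hle hc hga).superset
      subset_union_right
  · have hgX : g =ᵐ[(pmeas μ).restrict (Xset E)] a := ae_restrict_of_ae hga
    have hmem : restrictX μ g ∈ typeASet μ :=
      ⟨a, ⟨c, r, hr, hs, (pball_subset_Xset_iff _ (by positivity)).2 (by linarith), hi, h0, hle⟩,
        (restrictX_ae g).trans hgX⟩
    exact (atomicBound_of_mem (subset_union_left hmem)).mono (le_add_of_nonneg_right (by positivity))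

/-- The reflection `(t, x) ↦ (-t, x)` of `N`. -/
def reflect (E : Type*) [MeasurableSpace E] : ℝ × E ≃ᵐ ℝ × E :=
  (MeasurableEquiv.neg ℝ).prodCongr (MeasurableEquiv.refl E)

lemma measurePreserving_reflect (hμ : DoublingWith μ D) :
    MeasurePreserving (reflect E) (pmeas μ) (pmeas μ) := by
  have := hμ.sigmaFinite
  exact (Measure.measurePreserving_neg volume).prod (MeasurePreserving.id μ)

/-- The odd reflection of a type (b) atom is a multiple of a `(1,2)`-atom. -/
lemma IsTypeBAtom.exists_isAtom12 (hμ : DoublingWith μ D) (hD : 1 ≤ D)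
    {b : ℝ × E → ℝ} (hb : IsTypeBAtom μ b) :
    ∃ a, IsAtom12 μ a ∧ ∀ p ∈ Xset E, a p = (16 * D ^ 2)⁻¹ * b p := by
  obtain ⟨c, r, hr, hs, h2, h4, hi, hle⟩ := hb
  have hmp := measurePreserving_reflect (E := E) hμ
  have hir : Integrable (b ∘ reflect E) (pmeas μ) := hmp.integrable_comp_of_integrable hi
  rw [pball_subset_Xset_iff _ (by positivity)] at h2 h4
  refine ⟨(16 * D ^ 2)⁻¹ • (b - b ∘ reflect E), ⟨c, 8 * r, by positivity, ?_,
    (hi.sub hir).smul _, ?_, ?_⟩, fun p hp => ?_⟩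
  · intro p hp
    have hp' : b p ≠ 0 ∨ b (reflect E p) ≠ 0 := by
      by_contra! h
      exact hp (by simp [h.1, h.2])
    rcases hp' with hp | hp
    · exact pball_mono c (by linarith) (hs hp)
    · have h := (mem_pball_iff hr).1 (hs hp)
      rw [mem_pball_iff (by positivity)]
      have h1 : |-p.1 - c.1| < r ^ 2 := h.1
      have h3 : dist p.2 c.2 < r := h.2
      rw [abs_lt] at h1
      exact ⟨abs_lt.2 ⟨by nlinarith, by nlinarith⟩, by linarith⟩
  · have : ∫ p, (b ∘ reflect E) p ∂pmeas μ = ∫ p, b p ∂pmeas μ := hmp.integral_comp' b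
    simp only [Pi.smul_apply]
    rw [integral_smul, integral_sub' hi hir, this, sub_self, smul_zero]
  · set W := pmeas μ (pball c r)
    have hW0 : W ≠ 0 := (hμ.pmeas_pball_pos c hr).ne'
    have hWtop : W ≠ ⊤ := hμ.pmeas_pball_ne_top c hr
    have hbig : pmeas μ (pball c (8 * r)) ≤ ENNReal.ofReal (8 * D ^ 2) ^ 2 * W := by
      calc pmeas μ (pball c (8 * r)) = pmeas μ (pball c (2 * (2 * (2 * r)))) := by ring_nf
        _ ≤ ENNReal.ofReal (4 * D) * (ENNReal.ofReal (4 * D) * (ENNReal.ofReal (4 * D) * W)) := by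
            refine (hμ.pmeas_pball_two_mul_le _ (by positivity)).trans ?_
            gcongr
            refine (hμ.pmeas_pball_two_mul_le _ (by positivity)).trans ?_
            gcongr
            exact hμ.pmeas_pball_two_mul_le _ hr
        _ = ENNReal.ofReal ((4 * D) ^ 3) * W := by
            rw [ENNReal.ofReal_pow (by positivity)]
            ring
        _ ≤ _ := by
            rw [← ENNReal.ofReal_pow (by positivity)]
            gcongr ENNReal.ofReal ?_ * W
            nlinarith [pow_pos (one_pos.trans_le hD) 3]
    have hcomp : eLpNorm (b ∘ reflect E) 2 (pmeas μ) = eLpNorm b 2 (pmeas μ) :=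
      eLpNorm_comp_measurePreserving hi.1 hmp
    have hsub : eLpNorm (b - b ∘ reflect E) 2 (pmeas μ) ≤ 2 * W ^ (-(1 : ℝ) / 2) := by
      refine (eLpNorm_sub_le hi.1 hir.1 (by norm_num)).trans ?_
      rw [hcomp, ← two_mul]
      gcongr
    have hK : ‖(16 * D ^ 2)⁻¹‖ₑ * 2 = (ENNReal.ofReal (8 * D ^ 2))⁻¹ := by
      rw [Real.enorm_of_nonneg (by positivity), ← ENNReal.ofReal_inv_of_pos (by positivity),
        show (2 : ENNReal) = ENNReal.ofReal 2 by simp, ← ENNReal.ofReal_mul (by positivity)]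
      congr 1
      field_simp
      norm_num
    calc _ ≤ ‖(16 * D ^ 2)⁻¹‖ₑ * (2 * W ^ (-(1 : ℝ) / 2)) := by
          rw [eLpNorm_const_smul]
          gcongr
      _ = (ENNReal.ofReal (8 * D ^ 2) ^ 2 * W) ^ (-(1 : ℝ) / 2) := by
          rw [← mul_assoc, hK, ENNReal.mul_rpow_of_ne_top (ENNReal.pow_ne_top ENNReal.ofReal_ne_top) hWtop,
            ← ENNReal.rpow_natCast, ← ENNReal.rpow_mul]
          congr 1
          rw [← ENNReal.rpow_neg_one]
          norm_num
      _ ≤ _ := by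
          rw [rpow_neg_half_eq, rpow_neg_half_eq]
          gcongr
  · have hz : b (reflect E p) = 0 := by
      by_contra h
      have h1 : |-p.1 - c.1| < r ^ 2 := ((mem_pball_iff hr).1 (hs h)).1
      have h3 : 0 < p.1 := hp
      rw [abs_lt] at h1
      nlinarith
    simp [hz]

lemma exists_mem_atomSet_restrictX (hμ : DoublingWith μ D) (hD : 1 ≤ D) :
    ∀ g ∈ typeASet μ ∪ typeBSet μ, ∃ x ∈ atomSet μ, restrictX μ x = (16 * D ^ 2)⁻¹ • g := by
  have key {a b : ℝ × E → ℝ} {g : Lp ℝ 1 ((pmeas μ).restrict (Xset E))}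
      (hg : g =ᵐ[(pmeas μ).restrict (Xset E)] b) (ha : IsAtom12 μ a)
      (hab : ∀ p ∈ Xset E, a p = (16 * D ^ 2)⁻¹ * b p) :
      ∃ x ∈ atomSet μ, restrictX μ x = (16 * D ^ 2)⁻¹ • g := by
    refine ⟨ha.integrable.toL1, ⟨a, ha, ha.integrable.coeFn_toL1⟩, Lp.ext ?_⟩
    filter_upwards [restrictX_ae (μ := μ) ha.integrable.toL1,
      ae_restrict_of_ae ha.integrable.coeFn_toL1, Lp.coeFn_smul (16 * D ^ 2)⁻¹ g, hg,
      ae_restrict_mem measurableSet_Xset] with p h1 h2 h3 h4 h5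
    rw [h1, h2, h3, Pi.smul_apply, h4, hab p h5, smul_eq_mul]
  rintro g (⟨a, ha, hg⟩ | ⟨b, hb, hg⟩)
  · refine key hg (ha.isAtom12.const_mul (t := (16 * D ^ 2)⁻¹) ?_) fun _ _ => rfl
    rw [abs_of_nonneg (by positivity)]
    exact inv_le_one_of_one_le₀ (by nlinarith)
  · obtain ⟨a, ha, hab⟩ := hb.exists_isAtom12 hμ hD
    exact key hg ha hab

lemma HasL1Decomp.atomicBound (hμ : DoublingWith μ D) {f : ℝ × E → ℝ} (hf : Integrable f (pmeas μ))
    {lam : ℕ → ℝ} {a : ℕ → ℝ × E → ℝ} (ha : ∀ i, IsAtom12 μ (a i))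
    (h : HasL1Decomp (pmeas μ) f lam a) :
    AtomicBound (atomSet μ) hf.toL1 (∑' i, |lam i|) := by
  have hi (i : ℕ) : Integrable (a i) (pmeas μ) := (ha i).integrable
  have hmem (i : ℕ) : (hi i).toL1 ∈ atomSet μ := ⟨a i, ha i, (hi i).coeFn_toL1⟩
  refine ⟨lam, fun i => (hi i).toL1, hmem, h.1, le_rfl, ?_⟩
  rw [(summable_smul_of_summable_abs (fun i => norm_le_one_of_mem_atomSet hμ _ (hmem i))
    h.1).hasSum_iff_tendsto_nat]
  refine ((tendsto_toL1_iff hf (integrable_range_sum hi lam)).1 h.2).congr fun k => ?_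
  exact toL1_sum_smul hi lam k _

lemma AtomicBound.exists_hasL1Decomp {x : Lp ℝ 1 (pmeas μ)} {s : ℝ}
    (h : AtomicBound (atomSet μ) x s) :
    ∃ (lam : ℕ → ℝ) (a : ℕ → ℝ × E → ℝ), (∀ i, IsAtom12 μ (a i)) ∧
      HasL1Decomp (pmeas μ) x lam a ∧ ∑' i, |lam i| ≤ s := by
  obtain ⟨lam, g, hg, hl, hs, hsum⟩ := h
  choose a ha hga using hg
  have hi (i : ℕ) : Integrable (a i) (pmeas μ) := (ha i).integrable
  have hgi (i : ℕ) : (hi i).toL1 = g i := Lp.ext ((hi i).coeFn_toL1.trans (hga i).symm)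
  have hx : Integrable x (pmeas μ) := L1.integrable_coeFn x
  refine ⟨lam, a, ha, ⟨hl, ?_⟩, hs⟩
  rw [tendsto_toL1_iff hx (integrable_range_sum hi lam), Integrable.toL1_coeFn]
  refine hsum.tendsto_sum_nat.congr fun k => ?_
  rw [toL1_sum_smul hi lam k]
  simp only [hgi]

lemma HasRDecomp.atomicBound (hμ : DoublingWith μ D) {f : ℝ × E → ℝ}
    (hf : Integrable f ((pmeas μ).restrict (Xset E))) {lamA lamB : ℕ → ℝ}
    {a b : ℕ → ℝ × E → ℝ} (h : HasRDecomp μ f lamA a lamB b) :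
    AtomicBound (typeASet μ ∪ typeBSet μ) hf.toL1 ((∑' i, |lamA i|) + ∑' i, |lamB i|) := by
  obtain ⟨ha, hb, hlA, hlB, ht⟩ := h
  have hia (i : ℕ) : Integrable (a i) ((pmeas μ).restrict (Xset E)) :=
    (ha i).isAtom12.integrable.restrict
  have hib (i : ℕ) : Integrable (b i) ((pmeas μ).restrict (Xset E)) := (hb i).integrable.restrict
  refine AtomicBound.union (norm_le_one_of_mem_typeASet hμ) (norm_le_one_of_mem_typeBSet hμ)
    (a := fun i => (hia i).toL1) (b := fun i => (hib i).toL1)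
    (fun i => ⟨a i, ha i, (hia i).coeFn_toL1⟩) (fun i => ⟨b i, hb i, (hib i).coeFn_toL1⟩) hlA hlB ?_
  simp only [sub_sub] at ht
  refine ((tendsto_toL1_iff hf fun k => (integrable_range_sum hia lamA k).add
    (integrable_range_sum hib lamB k)).1 ht).congr fun k => ?_
  rw [← toL1_sum_smul hia lamA k (integrable_range_sum hia lamA k),
    ← toL1_sum_smul hib lamB k (integrable_range_sum hib lamB k)]
  exact Integrable.toL1_add _ _ _ _

lemma AtomicBound.exists_hasRDecomp (x : E) {f : ℝ × E → ℝ}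
    (hf : Integrable f ((pmeas μ).restrict (Xset E))) {s : ℝ}
    (h : AtomicBound (typeASet μ ∪ typeBSet μ) hf.toL1 s) :
    ∃ (lamA : ℕ → ℝ) (a : ℕ → ℝ × E → ℝ) (lamB : ℕ → ℝ) (b : ℕ → ℝ × E → ℝ),
      HasRDecomp μ f lamA a lamB b ∧ (∑' i, |lamA i|) + ∑' i, |lamB i| ≤ s := by
  obtain ⟨lamA, g, lamB, g', hg, hg', hlA, hlB, hs, hsum⟩ :=
    h.split_union (zero_mem_typeASet x) (zero_mem_typeBSet x)
  choose a ha hga using hg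
  choose b hb hgb using hg'
  have hia (i : ℕ) : Integrable (a i) ((pmeas μ).restrict (Xset E)) :=
    (ha i).isAtom12.integrable.restrict
  have hib (i : ℕ) : Integrable (b i) ((pmeas μ).restrict (Xset E)) := (hb i).integrable.restrict
  have hgi (i : ℕ) : (hia i).toL1 = g i := Lp.ext ((hia i).coeFn_toL1.trans (hga i).symm)
  have hgi' (i : ℕ) : (hib i).toL1 = g' i := Lp.ext ((hib i).coeFn_toL1.trans (hgb i).symm)
  refine ⟨lamA, a, lamB, b, ⟨ha, hb, hlA, hlB, ?_⟩, hs⟩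
  simp only [sub_sub]
  refine (tendsto_toL1_iff hf fun k => (integrable_range_sum hia lamA k).add
    (integrable_range_sum hib lamB k)).2 (hsum.tendsto_sum_nat.congr fun k => ?_)
  rw [Finset.sum_add_distrib]
  simp only [← hgi, ← hgi']
  rw [← toL1_sum_smul hia lamA k (integrable_range_sum hia lamA k),
    ← toL1_sum_smul hib lamB k (integrable_range_sum hib lamB k)]
  exact (Integrable.toL1_add _ _ _ _).symm

lemma H1norm_le {F : ℝ × E → ℝ} {lam : ℕ → ℝ} {a : ℕ → ℝ × E → ℝ} (ha : ∀ i, IsAtom12 μ (a i))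
    (h : HasL1Decomp (pmeas μ) F lam a) : H1norm μ F ≤ ∑' i, |lam i| := by
  refine csInf_le ⟨0, ?_⟩ ⟨lam, a, ha, h, rfl⟩
  rintro _ ⟨l, _, _, _, rfl⟩
  exact tsum_nonneg fun _ => abs_nonneg _

lemma H1norm_nonneg (F : ℝ × E → ℝ) : 0 ≤ H1norm μ F := by
  refine Real.sInf_nonneg ?_
  rintro _ ⟨l, _, _, _, rfl⟩
  exact tsum_nonneg fun _ => abs_nonneg _

lemma H1rnorm_le {f F : ℝ × E → ℝ} (hF : MemH1 μ F)
    (h : F =ᵐ[(pmeas μ).restrict (Xset E)] f) : H1rnorm μ f ≤ H1norm μ F := by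
  refine csInf_le ⟨0, ?_⟩ ⟨F, hF, h, rfl⟩
  rintro _ ⟨F', _, _, rfl⟩
  exact H1norm_nonneg F'

/-- A sum of type (a) and type (b) atoms extends to an element of `H¹(N)`. -/
lemma HasRDecomp.exists_extension (hμ : DoublingWith μ D) (hD : 1 ≤ D) {f : ℝ × E → ℝ}
    (hf : IntegrableOn f (Xset E) (pmeas μ)) {lamA lamB : ℕ → ℝ} {a b : ℕ → ℝ × E → ℝ}
    (h : HasRDecomp μ f lamA a lamB b) :
    ∃ F, MemH1 μ F ∧ F =ᵐ[(pmeas μ).restrict (Xset E)] f ∧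
      H1norm μ F ≤ 16 * D ^ 2 * ((∑' i, |lamA i|) + ∑' i, |lamB i|) := by
  obtain ⟨x, hx, hxb⟩ := (h.atomicBound hμ hf).exists_lift (norm_le_one_of_mem_atomSet hμ)
    (restrictX μ) (by positivity : 0 < 16 * D ^ 2) (exists_mem_atomSet_restrictX hμ hD)
  obtain ⟨lam, c, hc, hdec, hle⟩ := hxb.exists_hasL1Decomp
  refine ⟨x, ⟨L1.integrable_coeFn x, lam, c, hc, hdec⟩, ?_, (H1norm_le hc hdec).trans hle⟩
  refine (restrictX_ae x).symm.trans ?_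
  rw [hx]
  exact Integrable.coeFn_toL1 hf

/-- The restriction to `X` of an atomic sum on `N` is a sum of type (a) and type (b) atoms. -/
lemma HasL1Decomp.exists_hasRDecomp [BorelSpace E] (hμ : DoublingWith μ D) (hD : 1 ≤ D)
    {f F : ℝ × E → ℝ} (hf : IntegrableOn f (Xset E) (pmeas μ)) (hF : Integrable F (pmeas μ))
    (hFf : F =ᵐ[(pmeas μ).restrict (Xset E)] f) {lam : ℕ → ℝ} {c : ℕ → ℝ × E → ℝ}
    (hc : ∀ i, IsAtom12 μ (c i)) (h : HasL1Decomp (pmeas μ) F lam c) :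
    ∃ (lamA : ℕ → ℝ) (a : ℕ → ℝ × E → ℝ) (lamB : ℕ → ℝ) (b : ℕ → ℝ × E → ℝ),
      HasRDecomp μ f lamA a lamB b ∧
      (∑' i, |lamA i|) + ∑' i, |lamB i| ≤ (1 + (4 * D) ^ 3) * ∑' i, |lam i| := by
  obtain ⟨⟨_, x⟩, -⟩ := hc 0
  have hb := (h.atomicBound hμ hF hc).map (A' := typeASet μ ∪ typeBSet μ)
    (fun g hg => hg.elim (norm_le_one_of_mem_typeASet hμ g) (norm_le_one_of_mem_typeBSet hμ g))
    (restrictX μ) (K := 1 + (4 * D) ^ 3) (fun g hg => atomicBound_restrictX hμ hD hg)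
    (by positivity)
  have hF' : hF.toL1 =ᵐ[(pmeas μ).restrict (Xset E)] F := ae_restrict_of_ae hF.coeFn_toL1
  have heq : restrictX μ hF.toL1 = Integrable.toL1 f hf :=
    Lp.ext ((restrictX_ae _).trans (hF'.trans (hFf.trans (Integrable.coeFn_toL1 hf).symm)))
  rw [heq] at hb
  exact hb.exists_hasRDecomp x hf

end Hardy

/-- atomic characterization of `H¹_r(X)`: an integrable `f` on `X` lies in
`H¹_r(X)` iff it has a decomposition into type (a) and type (b) atoms with summable
coefficients, and the infimum of `Σ|λ_i| + Σ|μ_j|` over decompositions is equivalent to the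
`H¹_r(X)` norm with constants depending only on `C_D`. -/
theorem stmt1 (C_D : ℝ) (hCD : 1 ≤ C_D) :
    ∃ c C : ℝ, 0 < c ∧ 0 < C ∧
      ∀ (E : Type) (_ : MetricSpace E) (_ : MeasurableSpace E), BorelSpace E →
        ∀ μ : Measure E, DoublingWith μ C_D →
          ∀ f : ℝ × E → ℝ, IntegrableOn f (Xset E) (pmeas μ) →
            (MemH1r μ f ↔
              ∃ (lamA : ℕ → ℝ) (aA : ℕ → ℝ × E → ℝ) (lamB : ℕ → ℝ) (bB : ℕ → ℝ × E → ℝ),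
                HasRDecomp μ f lamA aA lamB bB) ∧
            (MemH1r μ f →
              c * H1rnorm μ f ≤
                sInf {s | ∃ (lamA : ℕ → ℝ) (aA : ℕ → ℝ × E → ℝ)
                    (lamB : ℕ → ℝ) (bB : ℕ → ℝ × E → ℝ),
                    HasRDecomp μ f lamA aA lamB bB ∧
                    s = (∑' i, |lamA i|) + ∑' j, |lamB j|} ∧
              sInf {s | ∃ (lamA : ℕ → ℝ) (aA : ℕ → ℝ × E → ℝ)
                    (lamB : ℕ → ℝ) (bB : ℕ → ℝ × E → ℝ),
                    HasRDecomp μ f lamA aA lamB bB ∧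
                    s = (∑' i, |lamA i|) + ∑' j, |lamB j|} ≤ C * H1rnorm μ f) := by
  refine ⟨(16 * C_D ^ 2)⁻¹, 1 + (4 * C_D) ^ 3, by positivity, by positivity,
    fun E _ _ _ μ hμ f hf => ?_⟩
  have hbdd : BddBelow {s | ∃ (lamA : ℕ → ℝ) (aA : ℕ → ℝ × E → ℝ)
      (lamB : ℕ → ℝ) (bB : ℕ → ℝ × E → ℝ), HasRDecomp μ f lamA aA lamB bB ∧
      s = (∑' i, |lamA i|) + ∑' j, |lamB j|} := by
    refine ⟨0, ?_⟩
    rintro _ ⟨lamA, _, lamB, _, _, rfl⟩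
    exact add_nonneg (tsum_nonneg fun _ => abs_nonneg _) (tsum_nonneg fun _ => abs_nonneg _)
  refine ⟨⟨?_, ?_⟩, fun hmem => ⟨?_, ?_⟩⟩
  · rintro ⟨-, F, ⟨hF, lam, c, hc, hdec⟩, hFf⟩
    obtain ⟨lamA, a, lamB, b, h, -⟩ := hdec.exists_hasRDecomp hμ hCD hf hF hFf hc
    exact ⟨lamA, a, lamB, b, h⟩
  · rintro ⟨lamA, a, lamB, b, h⟩
    obtain ⟨F, hF, hFf, -⟩ := h.exists_extension hμ hCD hf
    exact ⟨hf, F, hF, hFf⟩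
  · obtain ⟨-, F, ⟨hF, lam, c, hc, hdec⟩, hFf⟩ := hmem
    obtain ⟨lamA, a, lamB, b, h, -⟩ := hdec.exists_hasRDecomp hμ hCD hf hF hFf hc
    refine le_csInf ⟨_, lamA, a, lamB, b, h, rfl⟩ ?_
    rintro _ ⟨lamA, a, lamB, b, h, rfl⟩
    obtain ⟨F, hF, hFf, hle⟩ := h.exists_extension hμ hCD hf
    rw [inv_mul_le_iff₀ (by positivity)]
    exact (H1rnorm_le hF hFf).trans hle
  · obtain ⟨-, F₀, hF₀, hFf₀⟩ := hmem
    rw [← div_le_iff₀' (by positivity)]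
    refine le_csInf ⟨_, F₀, hF₀, hFf₀, rfl⟩ ?_
    rintro _ ⟨F, ⟨hF, lam₀, c₀, hc₀, hdec₀⟩, hFf, rfl⟩
    refine le_csInf ⟨_, lam₀, c₀, hc₀, hdec₀, rfl⟩ ?_
    rintro _ ⟨lam, c, hc, hdec, rfl⟩
    rw [div_le_iff₀' (by positivity)]
    obtain ⟨lamA, a, lamB, b, h, hle⟩ := hdec.exists_hasRDecomp hμ hCD hf hF hFf hc
    exact (csInf_le hbdd ⟨lamA, a, lamB, b, h, rfl⟩).trans hle
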